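/- Let n be odd, i an integer with gcd(i,n) = 1, and F : F_{2^n} → F_{2^n} the Gold function F(x) = x^{2^i+1}. Let e be the multiplicative inverse of 2^i+1 modulo 2^n−1. Then for all a ∈ F_{2^n} and all b ∈ F_{2^n} with b ≠ 0: W_F(a,b) = 0 if and only if Tr(a·b^{−e}) = 0; and for all a ∈ F_{2^n} with a ≠ 0 and all b ∈ F_{2^n}: δ_F(a,b) = 0 if and only if Tr(a^{−(2^i+1)}·b) = 0. -/

import Mathlib

open scoped Classical

/-- The sign `(−1)^{Tr(t)} ∈ ℤ`, with `Tr` the absolute trace of `F_{2^n}`. -/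
noncomputable def sgn {n : ℕ} (t : GaloisField 2 n) : ℤ :=
  (-1) ^ (Algebra.trace (ZMod 2) (GaloisField 2 n) t).val

/-- The weight enumerator `ν_S(a,b) = #{(u,v) ∈ S×S : u − v = (a,b)}`. -/
noncomputable def nu2 {n : ℕ} (S : Set (GaloisField 2 n × GaloisField 2 n))
    (g : GaloisField 2 n × GaloisField 2 n) : ℕ :=
  Nat.card {q : (GaloisField 2 n × GaloisField 2 n) × (GaloisField 2 n × GaloisField 2 n) //
    q.1 ∈ S ∧ q.2 ∈ S ∧ q.1 - q.2 = g}

/-- `S ⊆ F_{2^n} × F_{2^n}` is formally self dual under the trace pairing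
`⟨(x,y),(a,b)⟩ = (−1)^{Tr(ax+by)}`. -/
noncomputable def FSDTrace {n : ℕ} (S : Set (GaloisField 2 n × GaloisField 2 n)) : Prop :=
  ∀ a b : GaloisField 2 n,
    (∑ᶠ s ∈ S, sgn (a * s.1 + b * s.2)) ^ 2 = (Nat.card S : ℤ) * nu2 S (a, b)

/-- The graph `S_F = {(x, F(x)) : x ∈ F_{2^n}}`. -/
def graphSet {n : ℕ} (F : GaloisField 2 n → GaloisField 2 n) :
    Set (GaloisField 2 n × GaloisField 2 n) :=
  {q | ∃ x : GaloisField 2 n, q = (x, F x)}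

/-- `δ_F(a,b) = #{x : F(x+a) + F(x) = b}`. -/
noncomputable def deltaF {n : ℕ} (F : GaloisField 2 n → GaloisField 2 n)
    (a b : GaloisField 2 n) : ℕ :=
  Nat.card {x : GaloisField 2 n // F (x + a) + F x = b}

/-- The Walsh transform `W_F(a,b) = ∑_x (−1)^{Tr(bF(x)+ax)}`. -/
noncomputable def walsh {n : ℕ} (F : GaloisField 2 n → GaloisField 2 n)
    (a b : GaloisField 2 n) : ℤ :=
  ∑ᶠ x : GaloisField 2 n, sgn (b * F x + a * x)

section GoldFunction

variable {n : ℕ}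

noncomputable local instance : Fintype (GaloisField 2 n) := Fintype.ofFinite _

theorem neg_one_pow_val_eq_one_iff (z : ZMod 2) : (-1 : ℤ) ^ z.val = 1 ↔ z = 0 := by
  revert z; decide

theorem sgn_add (s t : GaloisField 2 n) : sgn (s + t) = sgn s * sgn t := by
  have key : ∀ x y : ZMod 2, (-1 : ℤ) ^ (x + y).val = (-1) ^ x.val * (-1) ^ y.val := by decide
  simp only [sgn, map_add, key]

theorem sgn_eq_one_iff (t : GaloisField 2 n) :
    sgn t = 1 ↔ Algebra.trace (ZMod 2) (GaloisField 2 n) t = 0 :=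
  neg_one_pow_val_eq_one_iff _

theorem sgn_zero : sgn (0 : GaloisField 2 n) = 1 := by simp [sgn_eq_one_iff]

theorem sgn_one (hn : Odd n) : sgn (1 : GaloisField 2 n) = -1 := by
  have h : Algebra.trace (ZMod 2) (GaloisField 2 n) 1 = 1 := by
    have := Algebra.trace_algebraMap (R := ZMod 2) (S := GaloisField 2 n) 1
    rw [map_one, GaloisField.finrank 2 hn.pos.ne'] at this
    rw [this, nsmul_one]
    exact ZMod.natCast_eq_one_iff_odd.mpr hn
  rw [sgn, h]
  rfl

theorem trace_pow_two_pow (i : ℕ) (t : GaloisField 2 n) :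
    Algebra.trace (ZMod 2) (GaloisField 2 n) (t ^ 2 ^ i) =
      Algebra.trace (ZMod 2) (GaloisField 2 n) t := by
  induction i with
  | zero => simp
  | succ i ih =>
    rw [pow_succ, pow_mul, ← ih]
    have := Algebra.trace_eq_of_algEquiv
      (FiniteField.frobeniusAlgEquivOfAlgebraic (ZMod 2) (GaloisField 2 n)) (t ^ 2 ^ i)
    simpa [ZMod.card] using this

theorem sgn_pow_two_pow (i : ℕ) (t : GaloisField 2 n) : sgn (t ^ 2 ^ i) = sgn t := by
  rw [sgn, sgn, trace_pow_two_pow]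

theorem bijective_pow_two_pow (i : ℕ) :
    Function.Bijective fun x : GaloisField 2 n => x ^ 2 ^ i :=
  bijective_iterateFrobenius (GaloisField 2 n) 2 i

theorem sum_sgn_mul (hn : n ≠ 0) (w : GaloisField 2 n) :
    ∑ x, sgn (w * x) = if w = 0 then (2 : ℤ) ^ n else 0 := by
  split_ifs with hw
  · have hc := GaloisField.card 2 n hn
    rw [Nat.card_eq_fintype_card] at hc
    simp [hw, sgn_zero, hc]
  · obtain ⟨y, hy⟩ : ∃ y, Algebra.trace (ZMod 2) (GaloisField 2 n) (w * y) ≠ 0 := by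
      by_contra! h
      exact hw ((traceForm_nondegenerate (ZMod 2) (GaloisField 2 n)).1 w h)
    have hy' : sgn (w * y) ≠ 1 := mt (sgn_eq_one_iff _).mp hy
    have h : ∑ x, sgn (w * x) = sgn (w * y) * ∑ x, sgn (w * x) := by
      rw [Finset.mul_sum, ← Equiv.sum_comp (Equiv.addLeft y)]
      simp [mul_add, sgn_add]
    have h2 : (sgn (w * y) - 1) * ∑ x, sgn (w * x) = 0 := by linarith
    exact (mul_eq_zero.mp h2).resolve_left (sub_ne_zero.mpr hy')

theorem sum_sgn_mul_pow_add_mul (hn : n ≠ 0) (i : ℕ) (u v : GaloisField 2 n) :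
    ∑ x, sgn (u * x ^ 2 ^ i + v * x) = if u = v ^ 2 ^ i then (2 : ℤ) ^ n else 0 := by
  have h (x : GaloisField 2 n) :
      sgn (u * x ^ 2 ^ i + v * x) = sgn ((u + v ^ 2 ^ i) * x ^ 2 ^ i) := by
    rw [sgn_add, ← sgn_pow_two_pow i (v * x), ← sgn_add, mul_pow, add_mul]
  simp_rw [h]
  rw [(bijective_pow_two_pow i).sum_comp fun x => sgn ((u + v ^ 2 ^ i) * x), sum_sgn_mul hn]
  simp only [CharTwo.add_eq_zero]

theorem pow_two_pow_eq_self_iff (hn : n ≠ 0) {i : ℕ} (hi : Nat.gcd i n = 1)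
    (u : GaloisField 2 n) : u ^ 2 ^ i = u ↔ u = 0 ∨ u = 1 := by
  constructor
  · intro h
    have h1 : Function.IsPeriodicPt (frobenius (GaloisField 2 n) 2) i u := by
      rw [Function.IsPeriodicPt, Function.IsFixedPt, iterate_frobenius, h]
    have h2 : Function.IsPeriodicPt (frobenius (GaloisField 2 n) 2) n u := by
      rw [Function.IsPeriodicPt, Function.IsFixedPt, iterate_frobenius,
        ← GaloisField.card 2 n hn, Nat.card_eq_fintype_card, FiniteField.pow_card]
    have h3 := h1.gcd h2
    rw [hi, Function.IsPeriodicPt, Function.IsFixedPt, iterate_frobenius] at h3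
    have h4 : u * (u - 1) = 0 := by linear_combination h3
    exact (mul_eq_zero.mp h4).imp id sub_eq_zero.mp
  · rintro (rfl | rfl) <;> simp

theorem sum_mul_ite_eq_zero_or_one (f : GaloisField 2 n → ℤ) (c : ℤ) :
    ∑ u, f u * (if u = 0 ∨ u = 1 then c else 0) = (f 0 + f 1) * c := by
  have h : (Finset.univ.filter fun u : GaloisField 2 n => u = 0 ∨ u = 1) = {0, 1} := by
    ext; simp
  simp_rw [mul_ite, mul_zero]
  rw [← Finset.sum_filter, h, Finset.sum_pair zero_ne_one, add_mul]

theorem add_pow_two_pow_add_one (i : ℕ) (x u : GaloisField 2 n) :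
    (x + u) ^ (2 ^ i + 1) + x ^ (2 ^ i + 1) =
      u ^ (2 ^ i + 1) + (u * x ^ 2 ^ i + u ^ 2 ^ i * x) := by
  rw [pow_succ, add_pow_char_pow]
  linear_combination CharTwo.add_self_eq_zero (x ^ (2 ^ i + 1))

theorem sq_sum_sgn_gold (hn : Odd n) {i : ℕ} (hi : Nat.gcd i n = 1) (a : GaloisField 2 n) :
    (∑ x, sgn (x ^ (2 ^ i + 1) + a * x)) ^ 2 = (1 - sgn a) * 2 ^ n := by
  have hi2 : Nat.gcd (i + i) n = 1 := by
    rw [← two_mul]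
    exact Nat.Coprime.mul_left (Nat.coprime_two_left.mpr hn) hi
  have hfix (u : GaloisField 2 n) : u = (u ^ 2 ^ i) ^ 2 ^ i ↔ u = 0 ∨ u = 1 := by
    rw [← pow_mul, ← pow_add, eq_comm, pow_two_pow_eq_self_iff hn.pos.ne' hi2]
  calc (∑ x, sgn (x ^ (2 ^ i + 1) + a * x)) ^ 2
      = ∑ x, ∑ u, sgn (x ^ (2 ^ i + 1) + a * x) *
          sgn ((x + u) ^ (2 ^ i + 1) + a * (x + u)) := by
        rw [sq, Finset.sum_mul]
        refine Finset.sum_congr rfl fun x _ => ?_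
        rw [← Equiv.sum_comp (Equiv.addLeft x), Finset.mul_sum]
        rfl
    _ = ∑ u, sgn (u ^ (2 ^ i + 1) + a * u) * ∑ x, sgn (u * x ^ 2 ^ i + u ^ 2 ^ i * x) := by
        rw [Finset.sum_comm]
        refine Finset.sum_congr rfl fun u _ => ?_
        rw [Finset.mul_sum]
        refine Finset.sum_congr rfl fun x _ => ?_
        rw [← sgn_add, ← sgn_add]
        congr 1
        linear_combination add_pow_two_pow_add_one i x u + CharTwo.add_self_eq_zero (a * x)
    _ = (1 - sgn a) * 2 ^ n := by
        simp_rw [sum_sgn_mul_pow_add_mul hn.pos.ne', hfix]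
        rw [sum_mul_ite_eq_zero_or_one]
        simp [sgn_add, sgn_one hn, sgn_zero]
        ring

theorem walsh_gold (i : ℕ) {c : GaloisField 2 n} (hc : c ≠ 0) (a : GaloisField 2 n) :
    walsh (fun x => x ^ (2 ^ i + 1)) a (c ^ (2 ^ i + 1)) =
      ∑ x, sgn (x ^ (2 ^ i + 1) + a * c⁻¹ * x) := by
  rw [walsh, finsum_eq_sum_of_fintype, ← Equiv.sum_comp (Equiv.mulLeft₀ c⁻¹ (inv_ne_zero hc))]
  refine Finset.sum_congr rfl fun x _ => ?_
  simp only [Equiv.mulLeft₀_apply]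
  rw [← mul_pow, mul_inv_cancel_left₀ hc, mul_assoc]

theorem deltaF_gold (hn : Odd n) {i : ℕ} (hi : Nat.gcd i n = 1) {a : GaloisField 2 n}
    (ha : a ≠ 0) (b : GaloisField 2 n) :
    (deltaF (fun x => x ^ (2 ^ i + 1)) a b : ℤ) =
      1 - sgn ((a⁻¹) ^ (2 ^ i + 1) * b) := by
  set d := (a⁻¹) ^ (2 ^ i + 1) * b with hd
  have hsol (y : GaloisField 2 n) :
      (a * y + a) ^ (2 ^ i + 1) + (a * y) ^ (2 ^ i + 1) = b ↔ y ^ 2 ^ i + y + 1 + d = 0 := by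
    have hb : b = a ^ (2 ^ i + 1) * d := by
      rw [hd, ← mul_assoc, ← mul_pow, mul_inv_cancel₀ ha, one_pow, one_mul]
    have hfactor : (a * y + a) ^ (2 ^ i + 1) + (a * y) ^ (2 ^ i + 1) =
        a ^ (2 ^ i + 1) * (y ^ 2 ^ i + y + 1) := by
      rw [add_pow_two_pow_add_one]
      ring
    rw [hfactor, CharTwo.add_eq_zero, ← mul_right_inj' (pow_ne_zero (2 ^ i + 1) ha) (c := d), ← hb]
  have hcount : (deltaF (fun x => x ^ (2 ^ i + 1)) a b : ℤ) =
      ∑ y : GaloisField 2 n, if y ^ 2 ^ i + y + 1 + d = 0 then 1 else 0 := by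
    rw [deltaF, Nat.card_eq_fintype_card, Fintype.card_subtype, Finset.card_filter,
      ← Equiv.sum_comp (Equiv.mulLeft₀ a ha)]
    push_cast
    simp only [Equiv.mulLeft₀_apply, hsol]
  have h : (deltaF (fun x => x ^ (2 ^ i + 1)) a b : ℤ) * 2 ^ n = (1 - sgn d) * 2 ^ n := by
    calc (deltaF (fun x => x ^ (2 ^ i + 1)) a b : ℤ) * 2 ^ n
        = ∑ y, ∑ t, sgn ((y ^ 2 ^ i + y + 1 + d) * t) := by
          simp_rw [hcount, Finset.sum_mul, sum_sgn_mul hn.pos.ne', ite_mul, one_mul, zero_mul]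
      _ = ∑ t, sgn (t * (1 + d)) * ∑ y, sgn (t * y ^ 2 ^ i + t * y) := by
          rw [Finset.sum_comm]
          refine Finset.sum_congr rfl fun t _ => ?_
          rw [Finset.mul_sum]
          refine Finset.sum_congr rfl fun y _ => ?_
          rw [← sgn_add]
          ring_nf
      _ = (1 - sgn d) * 2 ^ n := by
          simp_rw [sum_sgn_mul_pow_add_mul hn.pos.ne', eq_comm (b := _ ^ 2 ^ i),
            pow_two_pow_eq_self_iff hn.pos.ne' hi]
          rw [sum_mul_ite_eq_zero_or_one]
          simp [sgn_add, sgn_one hn, sgn_zero]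
          ring
  exact mul_right_cancel₀ (by positivity) h

theorem pow_eq_self_of_modEq_one (hn : n ≠ 0) {k : ℕ} (hk : k ≡ 1 [MOD 2 ^ n - 1])
    {b : GaloisField 2 n} (hb : b ≠ 0) : b ^ k = b := by
  have h : b ^ (2 ^ n - 1) = 1 := by
    have hc := FiniteField.pow_card_sub_one_eq_one b hb
    rwa [← Nat.card_eq_fintype_card, GaloisField.card 2 n hn] at hc
  simpa using pow_eq_pow_of_modEq hk h

end GoldFunction

theorem stmt13 (n i : ℕ) (hn : Odd n) (hi : Nat.gcd i n = 1)
    (e : ℕ) (he : (2 ^ i + 1) * e ≡ 1 [MOD 2 ^ n - 1]) :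
    let F : GaloisField 2 n → GaloisField 2 n := fun x => x ^ (2 ^ i + 1)
    (∀ a b : GaloisField 2 n, b ≠ 0 →
      (walsh F a b = 0 ↔ Algebra.trace (ZMod 2) (GaloisField 2 n) (a * (b⁻¹) ^ e) = 0)) ∧
    (∀ a b : GaloisField 2 n, a ≠ 0 →
      (deltaF F a b = 0 ↔
        Algebra.trace (ZMod 2) (GaloisField 2 n) ((a⁻¹) ^ (2 ^ i + 1) * b) = 0)) := by
  intro F
  refine ⟨fun a b hb => ?_, fun a b ha => ?_⟩
  · have hb' : (b ^ e) ^ (2 ^ i + 1) = b := by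
      rw [← pow_mul, mul_comm]
      exact pow_eq_self_of_modEq_one hn.pos.ne' he hb
    have hW := walsh_gold i (pow_ne_zero e hb) a
    rw [hb', ← inv_pow] at hW
    rw [← sgn_eq_one_iff, hW, ← pow_eq_zero_iff two_ne_zero, sq_sum_sgn_gold hn hi,
      mul_eq_zero_iff_right (by positivity), sub_eq_zero, eq_comm]
  · rw [← sgn_eq_one_iff, ← Int.natCast_eq_zero, deltaF_gold hn hi ha, sub_eq_zero, eq_comm]
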